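/- Let Ω be a nonempty open convex proper subset of ℝⁿ, let l : ℝⁿ → ℝ be a locally Lipschitz function, and set L = { (x, l(x)) : x ∈ ∂Ω } ⊂ ℝ^{n+1}. Then for every r > 0 and every K ≥ 0 that is a Lipschitz constant for l restricted to B_r(0) ∩ ∂Ω, there is a constant c > 0 depending only on n and K such that H^{n-1}( L ∩ B_r(0) ) ≤ c r^{n-1}, where B_r(0) on the left denotes the ball in ℝ^{n+1} and on the right in the Lipschitz hypothesis the ball in ℝⁿ. -/

import Mathlib

open Set Metric MeasureTheory
open scoped RealInnerProductSpace ENNReal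

/-- The `i`-th partial derivative of `u` at `x`. -/
noncomputable def pderiv' {n : ℕ} (u : EuclideanSpace ℝ (Fin n) → ℝ) (i : Fin n)
    (x : EuclideanSpace ℝ (Fin n)) : ℝ :=
  fderiv ℝ u x (EuclideanSpace.single i 1)

/-- The squared norm of the gradient of `u` at `x`: `|Du|² = ∑ᵢ (Dᵢu)²`. -/
noncomputable def gradSq {n : ℕ} (u : EuclideanSpace ℝ (Fin n) → ℝ)
    (x : EuclideanSpace ℝ (Fin n)) : ℝ :=
  ∑ i, (pderiv' u i x) ^ 2

/-- `u` satisfies the minimal surface equation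
`∑ᵢ Dᵢ( Dᵢu / √(1+|Du|²) ) = 0` at every point of `Ω`. -/
def MinimalSurfaceEq {n : ℕ} (u : EuclideanSpace ℝ (Fin n) → ℝ)
    (Ω : Set (EuclideanSpace ℝ (Fin n))) : Prop :=
  ∀ x ∈ Ω,
    ∑ i, pderiv' (fun y => pderiv' u i y / Real.sqrt (1 + gradSq u y)) i x = 0

/-- The point `(x, l x) ∈ ℝ^{n+1}` on the graph of `l`. -/
noncomputable def graphPt {n : ℕ} (l : EuclideanSpace ℝ (Fin n) → ℝ)
    (x : EuclideanSpace ℝ (Fin n)) : EuclideanSpace ℝ (Fin (n + 1)) :=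
  (EuclideanSpace.equiv (Fin (n + 1)) ℝ).symm
    (Fin.snoc (EuclideanSpace.equiv (Fin n) ℝ x) (l x))

theorem hm_rel_le {X Y : Type*} [MetricSpace X] [MeasurableSpace X] [BorelSpace X]
    [MetricSpace Y] [MeasurableSpace Y] [BorelSpace Y] (R : X → Y → Prop) (C : NNReal)
    (hR : ∀ x y x' y', R x y → R x' y' → dist y y' ≤ C * dist x x')
    (A : Set X) {d : ℝ} (hd : 0 ≤ d) :
    μH[d] {y | ∃ x ∈ A, R x y} ≤ (C : ℝ≥0∞) ^ d * μH[d] A := by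
  classical
  rcases isEmpty_or_nonempty Y with hY | hY
  · have : {y : Y | ∃ x ∈ A, R x y} = ∅ := Set.eq_empty_of_isEmpty _
    rw [this]; simp
  let f : X → Y := fun x => if h : ∃ y, R x y then h.choose else hY.some
  have hf : ∀ x, (∃ y, R x y) → R x (f x) := by
    intro x h
    simp only [f, dif_pos h]
    exact h.choose_spec
  have hl : LipschitzOnWith C f (A ∩ {x | ∃ y, R x y}) := by
    apply LipschitzOnWith.of_dist_le_mul
    intro x hx y hy
    exact hR _ _ _ _ (hf x hx.2) (hf y hy.2)
  have hsub : {y | ∃ x ∈ A, R x y} ⊆ f '' (A ∩ {x | ∃ y, R x y}) := by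
    rintro y ⟨x, hx, hxy⟩
    refine ⟨x, ⟨hx, y, hxy⟩, ?_⟩
    have := hR _ _ _ _ (hf x ⟨y, hxy⟩) hxy
    simp only [dist_self, mul_zero] at this
    exact dist_le_zero.mp this
  calc _ ≤ _ := measure_mono hsub
    _ ≤ _ := hl.hausdorffMeasure_image_le hd
    _ ≤ _ := by gcongr; exact Set.inter_subset_left

theorem graphPt_norm_sq {n : ℕ} (l : EuclideanSpace ℝ (Fin n) → ℝ) (p : EuclideanSpace ℝ (Fin n)) :
    ‖graphPt l p‖ ^ 2 = ‖p‖ ^ 2 + (l p) ^ 2 := by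
  simp [EuclideanSpace.norm_sq_eq, Fin.sum_univ_castSucc, graphPt]

theorem graphPt_dist_sq {n : ℕ} (l : EuclideanSpace ℝ (Fin n) → ℝ)
    (p q : EuclideanSpace ℝ (Fin n)) :
    ‖graphPt l p - graphPt l q‖ ^ 2 = ‖p - q‖ ^ 2 + (l p - l q) ^ 2 := by
  simp [EuclideanSpace.norm_sq_eq, Fin.sum_univ_castSucc, graphPt]

theorem graphPt_dist_le {n : ℕ} (l : EuclideanSpace ℝ (Fin n) → ℝ)
    (p q : EuclideanSpace ℝ (Fin n)) (K : ℝ) (hK : 0 ≤ K) (h : |l p - l q| ≤ K * ‖p - q‖) :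
    ‖graphPt l p - graphPt l q‖ ≤ (1 + K) * ‖p - q‖ := by
  apply le_of_sq_le_sq _ (by positivity)
  rw [graphPt_dist_sq]
  have h2 : (l p - l q) ^ 2 ≤ (K * ‖p - q‖) ^ 2 := by
    rw [← sq_abs]; gcongr
  nlinarith [mul_nonneg hK (sq_nonneg ‖p - q‖)]

theorem proj_dist_le {E : Type*} [NormedAddCommGroup E] [InnerProductSpace ℝ E]
    (x y p q : E) (h1 : ⟪x - p, q - p⟫ ≤ 0) (h2 : ⟪y - q, p - q⟫ ≤ 0) :
    ‖p - q‖ ≤ ‖x - y‖ := by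
  have h3 : ‖p - q‖ ^ 2 ≤ ⟪x - y, p - q⟫ := by
    rw [← real_inner_self_eq_norm_sq]
    have e1 : q - p = -(p - q) := by abel
    rw [e1, inner_neg_right] at h1
    have e2 : p - q = (x - y) - (x - p) + (y - q) := by abel
    have : ⟪p - q, p - q⟫ = ⟪x - y, p - q⟫ - ⟪x - p, p - q⟫ + ⟪y - q, p - q⟫ := by
      rw [← inner_sub_left, ← inner_add_left, ← e2]
    linarith
  have h4 := real_inner_le_norm (x - y) (p - q)
  by_contra hc
  push Not at hc
  nlinarith [norm_nonneg (x - y), norm_nonneg (p - q)]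

theorem support_normal {E : Type*} [NormedAddCommGroup E] [InnerProductSpace ℝ E]
    [CompleteSpace E] (Ω : Set E) (hne : Ω.Nonempty) (ho : IsOpen Ω) (hc : Convex ℝ Ω)
    (p : E) (hp : p ∉ Ω) : ∃ v : E, v ≠ 0 ∧ ∀ w ∈ closure Ω, ⟪v, w - p⟫ ≤ 0 := by
  obtain ⟨f, hf⟩ := geometric_hahn_banach_open_point hc ho hp
  refine ⟨(InnerProductSpace.toDual ℝ E).symm f, ?_, ?_⟩
  · intro h
    have : f = 0 := by simpa using h
    obtain ⟨a, ha⟩ := hne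
    have := hf a ha
    simp_all
  · intro w hw
    rw [InnerProductSpace.toDual_symm_apply]
    have hcl : IsClosed {w : E | f (w - p) ≤ 0} :=
      isClosed_le (by fun_prop) continuous_const
    refine closure_minimal ?_ hcl hw
    intro a ha
    have := hf a ha
    simp only [mem_setOf_eq, map_sub]; linarith

/-- A ray from an interior point of the cube hits a face. -/
theorem ray_hits {n : ℕ} (r : ℝ) (p v : EuclideanSpace ℝ (Fin n)) (hp : ‖p‖ < r) (hv : v ≠ 0) :
    ∃ t : ℝ, 0 ≤ t ∧ (∀ j, |(p + t • v) j| ≤ r) ∧ ∃ i, |(p + t • v) i| = r := by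
  obtain ⟨k, hk⟩ : ∃ k, v k ≠ 0 := by
    by_contra h
    push Not at h
    exact hv (by ext i; simpa using h i)
  let g : ℝ → ℝ := fun t => ‖(WithLp.ofLp p + t • WithLp.ofLp v : Fin n → ℝ)‖
  have hg : Continuous g := by fun_prop
  have hr : 0 < r := (norm_nonneg p).trans_lt hp
  have hpi : ∀ j, |p j| ≤ r := fun j => by
    have := PiLp.norm_apply_le p j
    rw [Real.norm_eq_abs] at this
    linarith
  have h0 : g 0 ≤ r := by
    simp only [g, zero_smul, add_zero]
    exact (pi_norm_le_iff_of_nonneg hr.le).2 hpi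
  have hT : r ≤ g (2 * r / |v k|) := by
    have h1 : ‖(WithLp.ofLp p + (2 * r / |v k|) • WithLp.ofLp v : Fin n → ℝ) k‖ ≤ _ :=
      norm_le_pi_norm _ k
    refine le_trans ?_ h1
    simp only [Pi.add_apply, Pi.smul_apply, smul_eq_mul, Real.norm_eq_abs]
    have h2 : |2 * r / |v k| * v k| = 2 * r := by
      rw [abs_mul, abs_div, abs_abs, div_mul_cancel₀ _ (abs_ne_zero.2 hk), abs_of_pos (by linarith)]
    have h3 := abs_sub_abs_le_abs_sub (2 * r / |v k| * v k) (-p k)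
    rw [abs_neg, h2, sub_neg_eq_add, add_comm (_ * _)] at h3
    linarith [hpi k]
  have hT0 : (0 : ℝ) ≤ 2 * r / |v k| := by positivity
  obtain ⟨t, ht, htr⟩ := intermediate_value_Icc hT0 hg.continuousOn ⟨h0, hT⟩
  have hle : ∀ j, |(p + t • v) j| ≤ r := by
    intro j
    rw [← htr]
    exact norm_le_pi_norm (WithLp.ofLp p + t • WithLp.ofLp v : Fin n → ℝ) j
  refine ⟨t, ht.1, hle, ?_⟩
  by_contra hcon
  push Not at hcon
  have : g t < r := (pi_norm_lt_iff hr).2 fun j => lt_of_le_of_ne (hle j) (hcon j)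
  linarith

/-- Parametrization of a face. -/
noncomputable def facePt {m : ℕ} (i : Fin (m + 1)) (s : ℝ) (u : Fin m → ℝ) :
    EuclideanSpace ℝ (Fin (m + 1)) := WithLp.toLp 2 (i.insertNth s u : Fin (m + 1) → ℝ)

theorem exists_face_lip (m : ℕ) : ∃ C : NNReal, ∀ (i : Fin (m + 1)) (s : ℝ) (u v : Fin m → ℝ),
    ‖facePt i s u - facePt i s v‖ ≤ C * dist u v := by
  refine ⟨((Fintype.card (Fin (m + 1)) : NNReal) ^ (1 / (2 : ℝ≥0∞)).toReal), fun i s u v => ?_⟩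
  · rw [← dist_eq_norm]
    have h := (PiLp.lipschitzWith_toLp 2 (fun _ : Fin (m + 1) => ℝ)).dist_le_mul
      (i.insertNth s u : Fin (m + 1) → ℝ) (i.insertNth s v : Fin (m + 1) → ℝ)
    refine h.trans ?_
    refine mul_le_mul_of_nonneg_left ?_ (NNReal.coe_nonneg _)
    refine (dist_pi_le_iff dist_nonneg).2 fun j => ?_
    refine Fin.succAboveCases i ?_ (fun k => ?_) j
    · simp
    · simpa using dist_le_pi_dist u v k

theorem boundary_graph_measure_growth
    (n : ℕ) (K : ℝ) (hK : 0 ≤ K) :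
    ∃ c > (0 : ℝ), ∀ (Ω : Set (EuclideanSpace ℝ (Fin n)))
      (l : EuclideanSpace ℝ (Fin n) → ℝ),
      Ω.Nonempty → IsOpen Ω → Convex ℝ Ω → Ω ≠ univ →
      LocallyLipschitz l →
      ∀ r > (0 : ℝ),
        (∀ x ∈ Metric.ball (0 : EuclideanSpace ℝ (Fin n)) r ∩ frontier Ω,
         ∀ y ∈ Metric.ball (0 : EuclideanSpace ℝ (Fin n)) r ∩ frontier Ω,
          |l x - l y| ≤ K * ‖x - y‖) →
        μH[(n : ℝ) - 1]
            ({p : EuclideanSpace ℝ (Fin (n + 1)) | ∃ x ∈ frontier Ω, p = graphPt l x}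
              ∩ Metric.ball 0 r)
          ≤ ENNReal.ofReal (c * r ^ ((n : ℝ) - 1)) := by
  rcases n with _ | m
  · refine ⟨1, one_pos, fun Ω l hne _ _ huniv => ?_⟩
    exact absurd (Subsingleton.eq_univ_of_nonempty hne) huniv
  obtain ⟨C, hC⟩ := exists_face_lip m
  let C' : NNReal := ⟨1 + K, by positivity⟩ * C
  refine ⟨((m + 1 : ℕ) * 2) * ((C' : ℝ) ^ m * 2 ^ m) + 1, by positivity, ?_⟩
  intro Ω l hne ho hc _ _ r hr hl
  have hd : ((m + 1 : ℕ) : ℝ) - 1 = m := by push_cast; ring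
  rw [hd]
  let R : Fin (m + 1) → Bool → (Fin m → ℝ) → EuclideanSpace ℝ (Fin (m + 1 + 1)) → Prop :=
    fun i b u P => ∃ p ∈ Metric.ball (0 : EuclideanSpace ℝ (Fin (m + 1))) r ∩ frontier Ω,
      P = graphPt l p ∧
      ∀ w ∈ closure Ω, ⟪facePt i (if b then r else -r) u - p, w - p⟫ ≤ 0
  let A : Set (Fin m → ℝ) := Set.Icc (fun _ => -r) (fun _ => r)
  have hR : ∀ i b x y x' y', R i b x y → R i b x' y' → dist y y' ≤ C' * dist x x' := by
    rintro i b x y x' y' ⟨p, hp, rfl, hpw⟩ ⟨q, hq, rfl, hqw⟩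
    rw [dist_eq_norm]
    refine (graphPt_dist_le l p q K hK (hl p hp q hq)).trans ?_
    have h1 := proj_dist_le _ _ p q (hpw q (frontier_subset_closure hq.2))
      (hqw p (frontier_subset_closure hp.2))
    have h2 := h1.trans (hC i _ x x')
    have : ((C' : NNReal) : ℝ) = (1 + K) * C := rfl
    rw [this, mul_assoc]
    gcongr
  have hcover : ({p : EuclideanSpace ℝ (Fin (m + 1 + 1)) | ∃ x ∈ frontier Ω, p = graphPt l x}
      ∩ Metric.ball 0 r) ⊆ ⋃ ib : Fin (m + 1) × Bool, {y | ∃ x ∈ A, R ib.1 ib.2 x y} := by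
    rintro P ⟨⟨p, hp, rfl⟩, hP⟩
    have hpr : ‖p‖ < r := by
      rw [mem_ball_zero_iff] at hP
      refine lt_of_le_of_lt (le_of_sq_le_sq ?_ (norm_nonneg _)) hP
      rw [graphPt_norm_sq]; nlinarith [sq_nonneg (l p)]
    have hpΩ : p ∉ Ω := by
      rw [ho.frontier_eq] at hp; exact hp.2
    obtain ⟨v, hv, hvw⟩ := support_normal Ω hne ho hc p hpΩ
    obtain ⟨t, ht, hle, i, hi⟩ := ray_hits r p v hpr hv
    obtain ⟨b, hb⟩ : ∃ b : Bool, (p + t • v) i = if b then r else -r := by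
      rcases (abs_eq hr.le).1 hi with h | h
      · exact ⟨true, by simpa using h⟩
      · exact ⟨false, by simpa using h⟩
    have hface : facePt i (if b then r else -r) (i.removeNth (WithLp.ofLp (p + t • v)))
        = p + t • v := by
      unfold facePt
      rw [← hb]
      ext j
      refine Fin.succAboveCases i ?_ (fun k => ?_) j
      · simp
      · simp [Fin.removeNth]
    refine mem_iUnion.2 ⟨(i, b), i.removeNth (WithLp.ofLp (p + t • v)), ?_, p, ?_, rfl, ?_⟩
    · exact ⟨fun j => (abs_le.1 (hle _)).1, fun j => (abs_le.1 (hle _)).2⟩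
    · exact ⟨by simpa using hpr, hp⟩
    · intro w hw
      simp only [hface, add_sub_cancel_left, inner_smul_left]
      exact mul_nonpos_of_nonneg_of_nonpos ht (hvw w hw)
  have hA : μH[(m : ℝ)] A = ENNReal.ofReal (2 * r) ^ m := by
    have := hausdorffMeasure_pi_real (ι := Fin m)
    rw [Fintype.card_fin] at this
    rw [this, Real.volume_Icc_pi]
    simp only [Finset.prod_const, Finset.card_univ, Fintype.card_fin]
    congr 2; ring
  refine (measure_mono hcover).trans ((measure_iUnion_le _).trans ?_)
  rw [tsum_fintype]
  refine (Finset.sum_le_sum fun ib _ => hm_rel_le _ C' (hR ib.1 ib.2) A (Nat.cast_nonneg m)).trans ?_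
  rw [hA, Finset.sum_const, Finset.card_univ, Fintype.card_prod, Fintype.card_fin,
    Fintype.card_bool, ENNReal.rpow_natCast, Real.rpow_natCast, nsmul_eq_mul]
  have e1 : (C' : ℝ≥0∞) = ENNReal.ofReal (C' : ℝ) := by simp
  rw [e1, ← ENNReal.ofReal_pow (by positivity), ← ENNReal.ofReal_pow (by positivity),
    ← ENNReal.ofReal_mul (by positivity), ← ENNReal.ofReal_natCast,
    ← ENNReal.ofReal_mul (by positivity)]
  apply ENNReal.ofReal_le_ofReal
  have : 0 ≤ r ^ m := by positivity
  rw [mul_pow]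
  push_cast
  nlinarith
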